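/- Moment generating function bound for low-degree functions on the symmetric group: Let n ≥ 1, d ∈ {1,…,n}, let σ be a uniformly random permutation of [n], and let φ be a multilinear polynomial of degree at most d with non-negative coefficients such that for all 0 ≤ k ≤ d: ‖D^k φ‖_∞ ≤ C_D, ‖∇ D^k φ‖_∞ ≤ C'_D, and ‖D^k U φ‖_∞ ≤ C_U, for constants C_D, C'_D, C_U ≥ 0. Define β_d := 6·d·C'_D·( max(0, log(4·C_D·n/C'_D)) + (2/n)(2 − e^{−2/n})/(1 − e^{−2/n}) ) and γ_d := (2β_d/3)·(2·E[φ] + C_U), and set m(θ) := log E[ exp(θ·(φ(σ) − E[φ])) ]. Then m(θ) ≤ γ_d·θ²/(2(1 − β_d·θ)) for all θ ∈ [0, 1/β_d), and m(θ) ≤ γ_d·θ²/2 for all θ ∈ (−1/β_d, 0]. -/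

import Mathlib

open MvPolynomial

noncomputable section

/-- The permutation matrix of `σ`, as an assignment of values to the indeterminates `X_{ij}`. -/
def permMat (n : ℕ) (σ : Equiv.Perm (Fin n)) : Fin n × Fin n → ℝ :=
  fun p => if σ p.1 = p.2 then 1 else 0

/-- Evaluation of a polynomial in the indeterminates `X_{ij}` at the permutation matrix of `σ`. -/
def permEval (n : ℕ) (φ : MvPolynomial (Fin n × Fin n) ℝ) (σ : Equiv.Perm (Fin n)) : ℝ :=
  eval (permMat n σ) φ

/-- Multilinearity: `∂_{ij}∂_{ik} φ ≡ 0` and `∂_{ji}∂_{ki} φ ≡ 0` for all `i, j, k`. -/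
def IsMultilinear (n : ℕ) (φ : MvPolynomial (Fin n × Fin n) ℝ) : Prop :=
  ∀ i j k : Fin n,
    pderiv (i, j) (pderiv (i, k) φ) = 0 ∧ pderiv (j, i) (pderiv (k, i) φ) = 0

/-- The operator `D`, defined on homogeneous components by
`Dφ = (1/(dn)) ∑_{ij} ∂_{ij} φ` and extended linearly (annihilating constants). -/
def Dop (n : ℕ) (φ : MvPolynomial (Fin n × Fin n) ℝ) : MvPolynomial (Fin n × Fin n) ℝ :=
  ∑ d ∈ Finset.range (φ.totalDegree + 1),
    (1 / ((d : ℝ) * (n : ℝ))) •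
      ∑ i : Fin n, ∑ j : Fin n, pderiv (i, j) (homogeneousComponent d φ)

/-- The operator `U`, defined on homogeneous components by
`Uφ(X) = (1/(dn)) ∑_{ijkl} X_{il} X_{kj} ∂_{ij}∂_{kl} φ(X)` and extended linearly. -/
def Uop (n : ℕ) (φ : MvPolynomial (Fin n × Fin n) ℝ) : MvPolynomial (Fin n × Fin n) ℝ :=
  ∑ d ∈ Finset.range (φ.totalDegree + 1),
    (1 / ((d : ℝ) * (n : ℝ))) •
      ∑ i : Fin n, ∑ j : Fin n, ∑ k : Fin n, ∑ l : Fin n,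
        X (i, l) * X (k, j) * pderiv (i, j) (pderiv (k, l) (homogeneousComponent d φ))

/-- Mean of `φ(σ)` over a uniformly random permutation `σ`. -/
def permExp (n : ℕ) (φ : MvPolynomial (Fin n × Fin n) ℝ) : ℝ :=
  (∑ σ : Equiv.Perm (Fin n), permEval n φ σ) / (Fintype.card (Equiv.Perm (Fin n)) : ℝ)

/-- The log-moment generating function `m(θ) = log E[exp(θ(φ(σ) − E[φ]))]`. -/
def logMgf (n : ℕ) (φ : MvPolynomial (Fin n × Fin n) ℝ) (θ : ℝ) : ℝ :=
  Real.log ((∑ σ : Equiv.Perm (Fin n), Real.exp (θ * (permEval n φ σ - permExp n φ))) /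
    (Fintype.card (Equiv.Perm (Fin n)) : ℝ))

/-- The constant `β_d`. -/
def betaConst (n d : ℕ) (CD CD' : ℝ) : ℝ :=
  6 * (d : ℝ) * CD' * (max 0 (Real.log (4 * CD * (n : ℝ) / CD')) +
    (2 / (n : ℝ)) * (2 - Real.exp (-2 / (n : ℝ))) / (1 - Real.exp (-2 / (n : ℝ))))

/-- The constant `γ_d`. -/
def gammaConst (n d : ℕ) (CD CD' CU EΦ : ℝ) : ℝ :=
  2 * betaConst n d CD CD' / 3 * (2 * EΦ + CU)

/-- The permutations that agree with `σ₀` outside `S`. -/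
def permsAgreeingOff {α : Type*} [Fintype α] [DecidableEq α] (S : Finset α)
    (σ₀ : Equiv.Perm α) : Finset (Equiv.Perm α) :=
  Finset.univ.filter fun σ => ∀ i, i ∉ S → σ i = σ₀ i

section Covariance

variable {α : Type*} [DecidableEq α]

lemma sum_erase_erase (T : Finset α) (D : α → α → ℝ) (hD : ∀ c, D c c = 0) :
    ∑ a ∈ T, ∑ c ∈ T.erase a, ∑ d ∈ T.erase a, D c d =
      ((T.card : ℝ) - 2) * ∑ c ∈ T, ∑ d ∈ T, D c d := by
  have h1 : ∀ a ∈ T, ∑ c ∈ T.erase a, ∑ d ∈ T.erase a, D c d =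
      ∑ c ∈ T, ∑ d ∈ T, D c d - ∑ d ∈ T, D a d - ∑ c ∈ T, D c a := by
    intro a ha
    have h2 : ∀ c, ∑ d ∈ T.erase a, D c d = ∑ d ∈ T, D c d - D c a := fun c => by
      rw [← Finset.add_sum_erase T _ ha]; ring
    simp only [h2, Finset.sum_sub_distrib]
    rw [← Finset.add_sum_erase T (fun c => ∑ d ∈ T, D c d) ha,
      ← Finset.add_sum_erase T (fun c => D c a) ha, hD]
    ring
  rw [Finset.sum_congr rfl h1, Finset.sum_sub_distrib, Finset.sum_sub_distrib, Finset.sum_const,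
    nsmul_eq_mul, Finset.sum_comm (s := T) (t := T) (f := fun x i => D i x)]
  ring

lemma swap_mul_eq_mul_swap (σ : Equiv.Perm α) (a y : α) :
    Equiv.swap (σ a) y * σ = σ * Equiv.swap a (σ.symm y) := by
  rw [Equiv.mul_swap_eq_swap_mul, Equiv.apply_symm_apply]

variable [Fintype α]

lemma mem_permsAgreeingOff {S : Finset α} {σ₀ σ : Equiv.Perm α} :
    σ ∈ permsAgreeingOff S σ₀ ↔ ∀ i, i ∉ S → σ i = σ₀ i := by
  simp [permsAgreeingOff]

lemma card_mul_sum_mul_sub {ι : Type*} (Y : Finset ι) (F G : ι → ℝ) :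
    (Y.card : ℝ) * ∑ x ∈ Y, F x * G x - (∑ x ∈ Y, F x) * ∑ x ∈ Y, G x =
      (1 / 2) * ∑ x ∈ Y, ∑ y ∈ Y, (F x - F y) * (G x - G y) := by
  have : ∀ x y, (F x - F y) * (G x - G y) =
      F x * G x + F y * G y - F x * G y - G x * F y := fun x y => by ring
  simp only [this, Finset.sum_add_distrib, Finset.sum_sub_distrib, Finset.sum_const,
    nsmul_eq_mul, ← Finset.mul_sum, ← Finset.sum_mul]
  ring

lemma image_eq_of_mem_permsAgreeingOff {T : Finset α} {σ₀ σ : Equiv.Perm α}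
    (h : σ ∈ permsAgreeingOff T σ₀) : T.image σ = T.image σ₀ := by
  rw [mem_permsAgreeingOff] at h
  refine Finset.eq_of_subset_of_card_le (fun y hy => ?_) ?_
  · obtain ⟨b, hb, rfl⟩ := Finset.mem_image.1 hy
    refine Finset.mem_image.2 ⟨σ₀.symm (σ b), ?_, by simp⟩
    by_contra hn
    have := h _ hn
    rw [Equiv.apply_symm_apply] at this
    have h2 := σ.injective this
    exact hn (h2.symm ▸ hb)
  · rw [Finset.card_image_of_injective _ σ.injective,
      Finset.card_image_of_injective _ σ₀.injective]

lemma swap_mul_mem_permsAgreeingOff {T : Finset α} {σ₀ σ : Equiv.Perm α}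
    (h : σ ∈ permsAgreeingOff T σ₀) {x y : α} (hx : x ∈ T.image σ₀) (hy : y ∈ T.image σ₀) :
    Equiv.swap x y * σ ∈ permsAgreeingOff T σ₀ := by
  rw [← image_eq_of_mem_permsAgreeingOff h] at hx hy
  rw [mem_permsAgreeingOff] at h ⊢
  intro i hi
  rw [Equiv.Perm.mul_apply, Equiv.swap_apply_of_ne_of_ne, h i hi]
  · rintro rfl
    exact hi (σ.injective.mem_finset_image.1 hx)
  · rintro rfl
    exact hi (σ.injective.mem_finset_image.1 hy)

lemma filter_permsAgreeingOff {T : Finset α} {a : α} (ha : a ∈ T) {σ₀ σ₁ : Equiv.Perm α}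
    (h : σ₁ ∈ permsAgreeingOff T σ₀) :
    (permsAgreeingOff T σ₀).filter (fun σ => σ a = σ₁ a) = permsAgreeingOff (T.erase a) σ₁ := by
  ext σ
  rw [mem_permsAgreeingOff] at h
  simp only [Finset.mem_filter, mem_permsAgreeingOff, Finset.mem_erase, not_and_or, not_not]
  constructor
  · rintro ⟨h1, h2⟩ i (rfl | hi)
    · exact h2
    · rw [h1 i hi, h i hi]
  · intro h1
    exact ⟨fun i hi => by rw [h1 i (Or.inr hi), h i hi], h1 a (Or.inl rfl)⟩

lemma sum_filter_apply_eq {T : Finset α} {a : α} {σ₀ : Equiv.Perm α}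
    {x y : α} (hx : x ∈ T.image σ₀) (hy : y ∈ T.image σ₀) (F : Equiv.Perm α → ℝ) :
    ∑ σ ∈ (permsAgreeingOff T σ₀).filter (fun σ => σ a = y), F σ =
      ∑ σ ∈ (permsAgreeingOff T σ₀).filter (fun σ => σ a = x), F (Equiv.swap x y * σ) := by
  symm
  refine Finset.sum_bij' (fun σ _ => Equiv.swap x y * σ) (fun σ _ => Equiv.swap x y * σ)
    ?_ ?_ ?_ ?_ ?_
  · intro σ hσ
    rw [Finset.mem_filter] at hσ ⊢
    exact ⟨swap_mul_mem_permsAgreeingOff hσ.1 hx hy, by simp [hσ.2]⟩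
  · intro σ hσ
    rw [Finset.mem_filter] at hσ ⊢
    exact ⟨swap_mul_mem_permsAgreeingOff hσ.1 hx hy, by simp [hσ.2]⟩
  · intro σ _
    simp [← mul_assoc]
  · intro σ _
    simp [← mul_assoc]
  · intro σ _
    rfl

lemma abs_sum_filter_sub_le {T : Finset α} {a : α} {σ₀ : Equiv.Perm α}
    {x y : α} (hx : x ∈ T.image σ₀) (hy : y ∈ T.image σ₀) (F : Equiv.Perm α → ℝ) :
    |∑ σ ∈ (permsAgreeingOff T σ₀).filter (fun σ => σ a = x), F σ -
      ∑ σ ∈ (permsAgreeingOff T σ₀).filter (fun σ => σ a = y), F σ| ≤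
    ∑ σ ∈ (permsAgreeingOff T σ₀).filter (fun σ => σ a = x),
      |F σ - F (σ * Equiv.swap a (σ.symm y))| := by
  rw [sum_filter_apply_eq hx hy, ← Finset.sum_sub_distrib]
  refine (Finset.abs_sum_le_sum_abs _ _).trans (le_of_eq (Finset.sum_congr rfl fun σ hσ => ?_))
  rw [← (Finset.mem_filter.1 hσ).2, swap_mul_eq_mul_swap]

lemma covariance_step {T : Finset α} {a : α} (ha : a ∈ T) (σ₀ : Equiv.Perm α)
    (f g : Equiv.Perm α → ℝ) (K : ℝ)
    (hf : ∀ σ b c, |f σ - f (σ * Equiv.swap b c)| ≤ K) (R : Equiv.Perm α → ℝ)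
    (ih : ∀ σ₁ : Equiv.Perm α,
      ((permsAgreeingOff (T.erase a) σ₁).card : ℝ) *
          ∑ σ ∈ permsAgreeingOff (T.erase a) σ₁, f σ * g σ -
        (∑ σ ∈ permsAgreeingOff (T.erase a) σ₁, f σ) *
          ∑ σ ∈ permsAgreeingOff (T.erase a) σ₁, g σ ≤
      ((permsAgreeingOff (T.erase a) σ₁).card : ℝ) *
        ∑ σ ∈ permsAgreeingOff (T.erase a) σ₁, R σ) :
    ((permsAgreeingOff T σ₀).card : ℝ) * ∑ σ ∈ permsAgreeingOff T σ₀, f σ * g σ -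
        (∑ σ ∈ permsAgreeingOff T σ₀, f σ) * ∑ σ ∈ permsAgreeingOff T σ₀, g σ ≤
      ((permsAgreeingOff T σ₀).card : ℝ) * ∑ σ ∈ permsAgreeingOff T σ₀,
        (R σ + K / (2 * T.card) * ∑ b ∈ T, |g σ - g (σ * Equiv.swap a b)|) := by
  set C := permsAgreeingOff T σ₀ with hC
  set Y := T.image σ₀ with hY
  set cls : α → Finset (Equiv.Perm α) := fun x => C.filter (fun σ => σ a = x) with hcls
  have hmaps : ∀ σ ∈ C, σ a ∈ Y := fun σ hσ => by
    rw [hY, ← image_eq_of_mem_permsAgreeingOff hσ]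
    exact Finset.mem_image_of_mem _ ha
  have hfib : ∀ h : Equiv.Perm α → ℝ, ∑ x ∈ Y, ∑ σ ∈ cls x, h σ = ∑ σ ∈ C, h σ :=
    fun h => Finset.sum_fiberwise_of_maps_to hmaps h
  have hYcard : (Y.card : ℝ) = T.card := by
    rw [hY, Finset.card_image_of_injective _ σ₀.injective]
  have hσ₀ : σ₀ ∈ C := mem_permsAgreeingOff.2 fun _ _ => rfl
  have hM : ∀ x ∈ Y, ((cls x).card : ℝ) = (cls (σ₀ a)).card := fun x hx => by
    have := sum_filter_apply_eq (a := a) (hmaps σ₀ hσ₀) hx (fun _ => 1)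
    simpa using this
  set M : ℝ := ((cls (σ₀ a)).card : ℝ)
  have hM0 : 0 ≤ M := Nat.cast_nonneg _
  have hCcard : (C.card : ℝ) = T.card * M := by
    have := hfib (fun _ => 1)
    simp only [Finset.sum_const, nsmul_eq_mul, mul_one] at this
    rw [← this, Finset.sum_congr rfl hM, Finset.sum_const, nsmul_eq_mul, hYcard]
  have ht : (0 : ℝ) < T.card := by exact_mod_cast Finset.card_pos.2 ⟨a, ha⟩
  have hih : ∀ x ∈ Y, M * ∑ σ ∈ cls x, f σ * g σ - (∑ σ ∈ cls x, f σ) * ∑ σ ∈ cls x, g σ ≤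
      M * ∑ σ ∈ cls x, R σ := fun x hx => by
    have h1 := swap_mul_mem_permsAgreeingOff hσ₀ (hmaps σ₀ hσ₀) hx
    have h2 := filter_permsAgreeingOff ha h1
    have h3 : (Equiv.swap (σ₀ a) x * σ₀) a = x := by simp
    rw [h3] at h2
    have := ih (Equiv.swap (σ₀ a) x * σ₀)
    rw [← h2] at this
    rw [← hM x hx]
    exact this
  have hK : 0 ≤ K := (abs_nonneg _).trans (hf 1 a a)
  have hbetween : (Y.card : ℝ) * ∑ x ∈ Y, (∑ σ ∈ cls x, f σ) * (∑ σ ∈ cls x, g σ) -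
      (∑ x ∈ Y, ∑ σ ∈ cls x, f σ) * (∑ x ∈ Y, ∑ σ ∈ cls x, g σ) ≤
      (M * K / 2) * ∑ σ ∈ C, ∑ b ∈ T, |g σ - g (σ * Equiv.swap a b)| := by
    rw [card_mul_sum_mul_sub]
    have h1 : ∀ x ∈ Y, ∀ y ∈ Y, ((∑ σ ∈ cls x, f σ) - ∑ σ ∈ cls y, f σ) *
        ((∑ σ ∈ cls x, g σ) - ∑ σ ∈ cls y, g σ) ≤
        (M * K) * ∑ σ ∈ cls x, |g σ - g (σ * Equiv.swap a (σ.symm y))| := by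
      intro x hx y hy
      refine (le_abs_self _).trans ?_
      rw [abs_mul]
      refine mul_le_mul ?_ (abs_sum_filter_sub_le hx hy g) (abs_nonneg _) (mul_nonneg hM0 hK)
      refine (abs_sum_filter_sub_le hx hy f).trans ?_
      refine (Finset.sum_le_card_nsmul _ _ K fun σ _ => hf σ _ _).trans ?_
      rw [nsmul_eq_mul]
      exact le_of_eq (congrArg (· * K) (hM x hx))
    have h2 : ∑ x ∈ Y, ∑ y ∈ Y, ∑ σ ∈ cls x, |g σ - g (σ * Equiv.swap a (σ.symm y))| =
        ∑ σ ∈ C, ∑ b ∈ T, |g σ - g (σ * Equiv.swap a b)| := by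
      rw [← hfib]
      refine Finset.sum_congr rfl fun x _ => ?_
      rw [Finset.sum_comm]
      refine Finset.sum_congr rfl fun σ hσ => ?_
      rw [hY, ← image_eq_of_mem_permsAgreeingOff (Finset.mem_filter.1 hσ).1,
        Finset.sum_image fun _ _ _ _ h => σ.injective h]
      simp
    calc _ ≤ (1 / 2) * ∑ x ∈ Y, ∑ y ∈ Y,
          (M * K) * ∑ σ ∈ cls x, |g σ - g (σ * Equiv.swap a (σ.symm y))| :=
          mul_le_mul_of_nonneg_left
            (Finset.sum_le_sum fun x hx => Finset.sum_le_sum fun y hy => h1 x hx y hy) (by norm_num)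
      _ = _ := by
          simp only [← Finset.mul_sum]
          rw [h2]
          ring
  have hwithin := Finset.sum_le_sum hih
  simp only [Finset.sum_sub_distrib, ← Finset.mul_sum, hfib] at hwithin hbetween
  rw [hYcard] at hbetween
  have hwithin' := mul_le_mul_of_nonneg_left hwithin ht.le
  rw [Finset.sum_add_distrib, ← Finset.mul_sum, hCcard]
  have e : T.card * M * (∑ σ ∈ C, R σ +
      K / (2 * T.card) * ∑ σ ∈ C, ∑ b ∈ T, |g σ - g (σ * Equiv.swap a b)|) =
      T.card * (M * ∑ σ ∈ C, R σ) +
        (M * K / 2) * ∑ σ ∈ C, ∑ b ∈ T, |g σ - g (σ * Equiv.swap a b)| := by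
    field_simp
  rw [e]
  linarith

/-- A function whose increments along transpositions are at most `K` has covariance with `g`
controlled by the average transposition increment of `g`. -/
lemma covariance_le_of_increments_le (f : Equiv.Perm α → ℝ) (g : Equiv.Perm α → ℝ) (K : ℝ)
    (hf : ∀ σ b c, |f σ - f (σ * Equiv.swap b c)| ≤ K) (T : Finset α) (σ₀ : Equiv.Perm α) :
    ((permsAgreeingOff T σ₀).card : ℝ) * ∑ σ ∈ permsAgreeingOff T σ₀, f σ * g σ -
        (∑ σ ∈ permsAgreeingOff T σ₀, f σ) * ∑ σ ∈ permsAgreeingOff T σ₀, g σ ≤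
      ((permsAgreeingOff T σ₀).card : ℝ) * ∑ σ ∈ permsAgreeingOff T σ₀,
        K / (2 * T.card) * ∑ b ∈ T, ∑ c ∈ T, |g σ - g (σ * Equiv.swap b c)| := by
  induction hn : T.card using Nat.strong_induction_on generalizing T σ₀ with
  | _ n ih =>
  rcases T.eq_empty_or_nonempty with rfl | hT
  · have : permsAgreeingOff (∅ : Finset α) σ₀ = {σ₀} := by
      ext σ
      simp [mem_permsAgreeingOff, Equiv.ext_iff]
    simp [this]
  have hpos : 0 < T.card := Finset.card_pos.2 hT
  have ht : (0 : ℝ) < T.card := by exact_mod_cast hpos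
  set C := permsAgreeingOff T σ₀
  have hK : 0 ≤ K := (abs_nonneg _).trans (hf 1 hT.choose hT.choose)
  have hstep : ∀ a ∈ T, _ := fun a ha =>
    covariance_step ha σ₀ f g K hf
      (fun σ => K / (2 * (T.erase a).card) *
        ∑ b ∈ T.erase a, ∑ c ∈ T.erase a, |g σ - g (σ * Equiv.swap b c)|)
      (fun σ₁ => ih _ (by rw [← hn]; exact Finset.card_erase_lt_of_mem ha) _ σ₁ rfl)
  have hsum := Finset.sum_le_sum hstep
  rw [Finset.sum_const, nsmul_eq_mul, ← Finset.mul_sum, Finset.sum_comm] at hsum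
  refine le_of_mul_le_mul_left (hsum.trans ?_) ht
  rw [mul_left_comm]
  refine mul_le_mul_of_nonneg_left ?_ (Nat.cast_nonneg _)
  rw [Finset.mul_sum]
  refine Finset.sum_le_sum fun σ _ => ?_
  set D : α → α → ℝ := fun b c => |g σ - g (σ * Equiv.swap b c)| with hD
  have hDnn : 0 ≤ ∑ b ∈ T, ∑ c ∈ T, D b c :=
    Finset.sum_nonneg fun _ _ => Finset.sum_nonneg fun _ _ => abs_nonneg _
  have hD0 : ∀ c, D c c = 0 := fun c => by simp [hD, ← Equiv.Perm.one_def]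
  rw [Finset.sum_add_distrib, ← Finset.mul_sum, ← hn]
  have hcard : ∀ a ∈ T, ((T.erase a).card : ℝ) = T.card - 1 := fun a ha => by
    rw [Finset.card_erase_of_mem ha, Nat.cast_sub hpos, Nat.cast_one]
  have h1 : ∑ a ∈ T, K / (2 * ((T.erase a).card : ℝ)) *
      ∑ b ∈ T.erase a, ∑ c ∈ T.erase a, D b c =
      K / (2 * ((T.card : ℝ) - 1)) * ∑ a ∈ T, ∑ b ∈ T.erase a, ∑ c ∈ T.erase a, D b c := by
    rw [Finset.mul_sum]
    exact Finset.sum_congr rfl fun a ha => by rw [hcard a ha]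
  change ∑ a ∈ T, K / (2 * ((T.erase a).card : ℝ)) *
      ∑ b ∈ T.erase a, ∑ c ∈ T.erase a, D b c + K / (2 * (T.card : ℝ)) * ∑ b ∈ T, ∑ c ∈ T, D b c ≤
      T.card * (K / (2 * (T.card : ℝ)) * ∑ b ∈ T, ∑ c ∈ T, D b c)
  rw [h1]
  rcases Nat.lt_or_ge T.card 2 with h2 | h2
  · have : T.card = 1 := by omega
    obtain ⟨b, rfl⟩ := Finset.card_eq_one.1 this
    simp [hD0]
  · rw [sum_erase_erase T D hD0]
    have ht2 : (2 : ℝ) ≤ T.card := by exact_mod_cast h2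
    generalize (∑ b ∈ T, ∑ c ∈ T, D b c) = Q at hDnn
    generalize (T.card : ℝ) = t at ht ht2
    have e : t * (K / (2 * t) * Q) -
        (K / (2 * (t - 1)) * ((t - 2) * Q) + K / (2 * t) * Q) =
        K * Q / (2 * t * (t - 1)) := by
      have : t - 1 ≠ 0 := by linarith
      field_simp
      ring
    have : 0 ≤ K * Q / (2 * t * (t - 1)) :=
      div_nonneg (mul_nonneg hK hDnn) (mul_nonneg (by linarith) (by linarith))
    linarith

lemma abs_covariance_le_of_increments_le (f g : Equiv.Perm α → ℝ) (K : ℝ)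
    (hf : ∀ σ b c, |f σ - f (σ * Equiv.swap b c)| ≤ K) :
    |(Fintype.card (Equiv.Perm α) : ℝ) * ∑ σ, f σ * g σ - (∑ σ, f σ) * ∑ σ, g σ| ≤
      (Fintype.card (Equiv.Perm α) : ℝ) * (K / (2 * Fintype.card α) *
        ∑ b, ∑ c, ∑ σ, |g σ - g (σ * Equiv.swap b c)|) := by
  have huniv : permsAgreeingOff Finset.univ (1 : Equiv.Perm α) = Finset.univ := by
    ext; simp [mem_permsAgreeingOff]
  have hcomm : ∑ σ, ∑ b, ∑ c, |g σ - g (σ * Equiv.swap b c)| =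
      ∑ b, ∑ c, ∑ σ, |g σ - g (σ * Equiv.swap b c)| := by
    rw [Finset.sum_comm]
    exact Finset.sum_congr rfl fun b _ => Finset.sum_comm
  have h1 := covariance_le_of_increments_le f g K hf Finset.univ 1
  have h2 := covariance_le_of_increments_le (fun σ => -f σ) g K
    (fun σ b c => by rw [neg_sub_neg, abs_sub_comm]; exact hf σ b c)
    Finset.univ 1
  rw [huniv, ← Finset.mul_sum, hcomm] at h1 h2
  simp only [Finset.card_univ, neg_mul, Finset.sum_neg_distrib, mul_neg] at h1 h2
  rw [abs_le]
  constructor <;> linarith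

end Covariance

section Evaluation

variable {n : ℕ}

lemma permMat_nonneg (σ : Equiv.Perm (Fin n)) (q : Fin n × Fin n) : 0 ≤ permMat n σ q := by
  unfold permMat; split_ifs <;> norm_num

lemma permMat_self (σ : Equiv.Perm (Fin n)) (a : Fin n) : permMat n σ (a, σ a) = 1 := by
  simp [permMat]

lemma monomialEval_nonneg (σ : Equiv.Perm (Fin n)) (m : Fin n × Fin n →₀ ℕ) :
    0 ≤ ∏ q ∈ m.support, permMat n σ q ^ m q :=
  Finset.prod_nonneg fun q _ => pow_nonneg (permMat_nonneg σ q) _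

lemma permEval_eq_sum (φ : MvPolynomial (Fin n × Fin n) ℝ) (σ : Equiv.Perm (Fin n)) :
    permEval n φ σ = ∑ m ∈ φ.support, φ.coeff m * ∏ q ∈ m.support, permMat n σ q ^ m q :=
  eval_eq _ _

lemma permEval_pderiv_eq_sum (φ : MvPolynomial (Fin n × Fin n) ℝ) (σ : Equiv.Perm (Fin n))
    (a : Fin n) :
    permEval n (pderiv (a, σ a) φ) σ = ∑ m ∈ φ.support,
      φ.coeff m * (m (a, σ a) * ∏ q ∈ m.support, permMat n σ q ^ m q) := by
  have h1 : permEval n (pderiv (a, σ a) φ) σ = permEval n (X (a, σ a) * pderiv (a, σ a) φ) σ := by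
    simp [permEval, permMat_self]
  rw [h1]
  conv_lhs => rw [φ.as_sum]
  rw [map_sum, Finset.mul_sum]
  simp only [permEval, map_sum, X_mul_pderiv_monomial]
  refine Finset.sum_congr rfl fun m _ => ?_
  rw [map_nsmul, eval_monomial, nsmul_eq_mul, Finsupp.prod]
  ring

lemma permEval_nonneg {φ : MvPolynomial (Fin n × Fin n) ℝ} (hpos : ∀ m, 0 ≤ φ.coeff m)
    (σ : Equiv.Perm (Fin n)) : 0 ≤ permEval n φ σ := by
  rw [permEval_eq_sum]
  exact Finset.sum_nonneg fun m _ => mul_nonneg (hpos m) (monomialEval_nonneg σ m)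

lemma permEval_pderiv_nonneg {φ : MvPolynomial (Fin n × Fin n) ℝ} (hpos : ∀ m, 0 ≤ φ.coeff m)
    (σ : Equiv.Perm (Fin n)) (a : Fin n) : 0 ≤ permEval n (pderiv (a, σ a) φ) σ := by
  rw [permEval_pderiv_eq_sum]
  exact Finset.sum_nonneg fun m _ =>
    mul_nonneg (hpos m) (mul_nonneg (Nat.cast_nonneg _) (monomialEval_nonneg σ m))

lemma sum_permEval_pderiv_le {φ : MvPolynomial (Fin n × Fin n) ℝ} (hpos : ∀ m, 0 ≤ φ.coeff m)
    {d : ℕ} (hdeg : φ.totalDegree ≤ d) (σ : Equiv.Perm (Fin n)) :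
    ∑ a, permEval n (pderiv (a, σ a) φ) σ ≤ d * permEval n φ σ := by
  simp only [permEval_pderiv_eq_sum]
  rw [permEval_eq_sum, Finset.sum_comm, Finset.mul_sum]
  refine Finset.sum_le_sum fun m hm => ?_
  rw [← Finset.mul_sum, ← Finset.sum_mul, mul_left_comm (d : ℝ)]
  refine mul_le_mul_of_nonneg_left ?_ (hpos m)
  refine mul_le_mul_of_nonneg_right ?_ (monomialEval_nonneg σ m)
  rw [← Nat.cast_sum, Nat.cast_le]
  refine le_trans ?_ ((le_totalDegree hm).trans hdeg)
  rw [Finsupp.sum_fintype _ _ fun _ => rfl, Fintype.sum_prod_type]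
  exact Finset.sum_le_sum fun a _ =>
    Finset.single_le_sum (f := fun j => m (a, j)) (fun _ _ => Nat.zero_le _) (Finset.mem_univ _)

lemma monomialEval_le_mul_swap_add (σ : Equiv.Perm (Fin n)) (a b : Fin n)
    (m : Fin n × Fin n →₀ ℕ) :
    ∏ q ∈ m.support, permMat n σ q ^ m q ≤
      ∏ q ∈ m.support, permMat n (σ * Equiv.swap a b) q ^ m q +
        (m (a, σ a) * ∏ q ∈ m.support, permMat n σ q ^ m q +
          m (b, σ b) * ∏ q ∈ m.support, permMat n σ q ^ m q) := by
  have h0 := monomialEval_nonneg σ m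
  have h1 := monomialEval_nonneg (σ * Equiv.swap a b) m
  by_cases ha : m (a, σ a) = 0
  · by_cases hb : m (b, σ b) = 0
    · rw [ha, hb]
      simp only [Nat.cast_zero, zero_mul, add_zero]
      refine Finset.prod_le_prod (fun q _ => pow_nonneg (permMat_nonneg σ q) _) fun q hq => ?_
      refine pow_le_pow_left₀ (permMat_nonneg σ q) ?_ _
      have hq0 : m q ≠ 0 := Finsupp.mem_support_iff.1 hq
      by_cases hσ : σ q.1 = q.2
      · have hqa : q.1 ≠ a := by
          rintro rfl
          exact hq0 (by rw [hσ] at ha; exact ha)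
        have hqb : q.1 ≠ b := by
          rintro rfl
          exact hq0 (by rw [hσ] at hb; exact hb)
        simp [permMat, Equiv.swap_apply_of_ne_of_ne hqa hqb]
      · have : permMat n σ q = 0 := by simp [permMat, hσ]
        rw [this]
        exact permMat_nonneg _ _
    · have : (1 : ℝ) ≤ m (b, σ b) := by exact_mod_cast Nat.one_le_iff_ne_zero.2 hb
      have h2 : (0 : ℝ) ≤ m (a, σ a) := Nat.cast_nonneg _
      nlinarith
  · have : (1 : ℝ) ≤ m (a, σ a) := by exact_mod_cast Nat.one_le_iff_ne_zero.2 ha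
    have h2 : (0 : ℝ) ≤ m (b, σ b) := Nat.cast_nonneg _
    nlinarith

lemma permEval_sub_mul_swap_le {φ : MvPolynomial (Fin n × Fin n) ℝ} (hpos : ∀ m, 0 ≤ φ.coeff m)
    (σ : Equiv.Perm (Fin n)) (a b : Fin n) :
    permEval n φ σ - permEval n φ (σ * Equiv.swap a b) ≤
      permEval n (pderiv (a, σ a) φ) σ + permEval n (pderiv (b, σ b) φ) σ := by
  rw [permEval_pderiv_eq_sum, permEval_pderiv_eq_sum, permEval_eq_sum, permEval_eq_sum,
    sub_le_iff_le_add', ← Finset.sum_add_distrib, ← Finset.sum_add_distrib]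
  refine Finset.sum_le_sum fun m _ => ?_
  rw [← mul_add, ← mul_add]
  exact mul_le_mul_of_nonneg_left (monomialEval_le_mul_swap_add σ a b m) (hpos m)

end Evaluation

section Exponential

lemma abs_exp_sub_exp_le {θ x y u v : ℝ} (hxy : x - y ≤ u) (hyx : y - x ≤ v)
    (hu : 0 ≤ u) (hv : 0 ≤ v) (hθ : |θ| * |x - y| ≤ 1 / 3) :
    |Real.exp (θ * x) - Real.exp (θ * y)| ≤
      3 / 2 * |θ| * (u * Real.exp (θ * x) + v * Real.exp (θ * y)) := by
  have key : ∀ s : ℝ, |s| ≤ 1 / 3 → |1 - Real.exp s| ≤ 3 / 2 * |s| := by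
    intro s hs
    have h1 := Real.abs_exp_sub_one_sub_id_le (x := s) (by linarith)
    have h2 : |1 - Real.exp s| ≤ |Real.exp s - 1 - s| + |s| := by
      rw [abs_sub_comm]
      have := abs_add_le (Real.exp s - 1 - s) s
      simpa using this
    have h3 : s ^ 2 = |s| * |s| := by rw [← sq, sq_abs]
    nlinarith [abs_nonneg s]
  have main : ∀ x y w : ℝ, |θ| * |x - y| ≤ 1 / 3 → |x - y| ≤ w →
      |Real.exp (θ * x) - Real.exp (θ * y)| ≤ 3 / 2 * |θ| * (w * Real.exp (θ * x)) := by
    intro x y w h hw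
    have e : Real.exp (θ * x) - Real.exp (θ * y) =
        Real.exp (θ * x) * (1 - Real.exp (θ * (y - x))) := by
      rw [mul_sub, ← Real.exp_add, mul_one]
      ring_nf
    have hs : |θ * (y - x)| = |θ| * |x - y| := by rw [abs_mul, abs_sub_comm]
    rw [e, abs_mul, abs_of_pos (Real.exp_pos _)]
    have h1 := key _ (hs ▸ h)
    have h2 : |θ * (y - x)| ≤ |θ| * w := hs ▸ mul_le_mul_of_nonneg_left hw (abs_nonneg _)
    calc _ ≤ Real.exp (θ * x) * (3 / 2 * (|θ| * w)) :=
          mul_le_mul_of_nonneg_left (by linarith) (Real.exp_pos _).le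
      _ = _ := by ring
  have hcoef : 0 ≤ 3 / 2 * |θ| := by positivity
  rcases le_total y x with h | h
  · refine (main x y u hθ (by rwa [abs_of_nonneg (by linarith)])).trans ?_
    exact mul_le_mul_of_nonneg_left (le_add_of_nonneg_right (by positivity)) hcoef
  · rw [abs_sub_comm]
    rw [abs_sub_comm] at hθ
    refine (main y x v hθ (by rwa [abs_of_nonneg (by linarith)])).trans ?_
    exact mul_le_mul_of_nonneg_left (le_add_of_nonneg_left (by positivity)) hcoef

end Exponential

section MomentGeneratingFunction

variable {n : ℕ}

lemma sum_abs_exp_increments_le {φ : MvPolynomial (Fin n × Fin n) ℝ}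
    (hpos : ∀ m, 0 ≤ φ.coeff m) {d : ℕ} (hdeg : φ.totalDegree ≤ d) {θ K : ℝ}
    (hinc : ∀ σ b c, |permEval n φ σ - permEval n φ (σ * Equiv.swap b c)| ≤ K)
    (hθ : |θ| * K ≤ 1 / 3) :
    ∑ b, ∑ c, ∑ σ, |Real.exp (θ * permEval n φ σ) -
        Real.exp (θ * permEval n φ (σ * Equiv.swap b c))| ≤
      6 * n * d * |θ| * ∑ σ, permEval n φ σ * Real.exp (θ * permEval n φ σ) := by
  set f := permEval n φ with hf
  set L : Fin n → Equiv.Perm (Fin n) → ℝ := fun a σ => permEval n (pderiv (a, σ a) φ) σ with hL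
  have hL0 : ∀ a σ, 0 ≤ L a σ := fun a σ => permEval_pderiv_nonneg hpos σ a
  have hpair : ∀ b c, ∑ σ, |Real.exp (θ * f σ) - Real.exp (θ * f (σ * Equiv.swap b c))| ≤
      3 * |θ| * ∑ σ, (L b σ + L c σ) * Real.exp (θ * f σ) := by
    intro b c
    have h1 : ∀ σ, |Real.exp (θ * f σ) - Real.exp (θ * f (σ * Equiv.swap b c))| ≤
        3 / 2 * |θ| * ((L b σ + L c σ) * Real.exp (θ * f σ) +
          (L b (σ * Equiv.swap b c) + L c (σ * Equiv.swap b c)) *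
            Real.exp (θ * f (σ * Equiv.swap b c))) := by
      intro σ
      refine abs_exp_sub_exp_le (permEval_sub_mul_swap_le hpos σ b c) ?_
        (add_nonneg (hL0 _ _) (hL0 _ _)) (add_nonneg (hL0 _ _) (hL0 _ _))
        ((mul_le_mul_of_nonneg_left (hinc σ b c) (abs_nonneg _)).trans hθ)
      have := permEval_sub_mul_swap_le hpos (σ * Equiv.swap b c) b c
      rwa [mul_assoc, Equiv.swap_mul_self, mul_one] at this
    refine (Finset.sum_le_sum fun σ _ => h1 σ).trans (le_of_eq ?_)
    rw [← Finset.mul_sum, Finset.sum_add_distrib]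
    have h2 := Equiv.sum_comp (Equiv.mulRight (Equiv.swap b c))
      (fun σ => (L b σ + L c σ) * Real.exp (θ * f σ))
    simp only [Equiv.coe_mulRight] at h2
    rw [h2]
    ring
  have hLsum : ∀ σ, ∑ b, ∑ c, (L b σ + L c σ) * Real.exp (θ * f σ) ≤
      2 * n * d * (f σ * Real.exp (θ * f σ)) := by
    intro σ
    have h1 := sum_permEval_pderiv_le hpos hdeg σ
    have h2 : ∑ b, ∑ c, (L b σ + L c σ) * Real.exp (θ * f σ) =
        2 * n * ((∑ a, L a σ) * Real.exp (θ * f σ)) := by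
      simp only [← Finset.sum_mul, Finset.sum_add_distrib, Finset.sum_const, Finset.card_univ,
        Fintype.card_fin, nsmul_eq_mul, ← Finset.mul_sum]
      ring
    rw [h2]
    have h3 : (∑ a, L a σ) * Real.exp (θ * f σ) ≤ (d * f σ) * Real.exp (θ * f σ) :=
      mul_le_mul_of_nonneg_right h1 (Real.exp_pos _).le
    have h4 := mul_le_mul_of_nonneg_left h3 (show (0 : ℝ) ≤ 2 * n by positivity)
    linarith
  have h3 : ∑ b, ∑ c, ∑ σ, (L b σ + L c σ) * Real.exp (θ * f σ) =
      ∑ σ, ∑ b, ∑ c, (L b σ + L c σ) * Real.exp (θ * f σ) := by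
    conv_rhs => rw [Finset.sum_comm]
    exact Finset.sum_congr rfl fun b _ => Finset.sum_comm
  calc _ ≤ ∑ b, ∑ c, 3 * |θ| * ∑ σ, (L b σ + L c σ) * Real.exp (θ * f σ) :=
        Finset.sum_le_sum fun b _ => Finset.sum_le_sum fun c _ => hpair b c
    _ = 3 * |θ| * ∑ σ, ∑ b, ∑ c, (L b σ + L c σ) * Real.exp (θ * f σ) := by
        rw [← h3]; simp only [Finset.mul_sum]
    _ ≤ 3 * |θ| * ∑ σ, 2 * n * d * (f σ * Real.exp (θ * f σ)) :=
        mul_le_mul_of_nonneg_left (Finset.sum_le_sum fun σ _ => hLsum σ) (by positivity)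
    _ = _ := by rw [← Finset.mul_sum]; ring

lemma abs_permEval_sub_mul_swap_le {φ : MvPolynomial (Fin n × Fin n) ℝ}
    (hpos : ∀ m, 0 ≤ φ.coeff m) {c : ℝ}
    (hgrad : ∀ σ, ∀ q : Fin n × Fin n, |permEval n (pderiv q φ) σ| ≤ c)
    (σ : Equiv.Perm (Fin n)) (a b : Fin n) :
    |permEval n φ σ - permEval n φ (σ * Equiv.swap a b)| ≤ 2 * c := by
  have hle : ∀ σ, permEval n φ σ - permEval n φ (σ * Equiv.swap a b) ≤ 2 * c := fun σ => by
    have h1 := (le_abs_self _).trans (hgrad σ (a, σ a))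
    have h2 := (le_abs_self _).trans (hgrad σ (b, σ b))
    have h3 := permEval_sub_mul_swap_le hpos σ a b
    linarith
  have h := hle (σ * Equiv.swap a b)
  rw [mul_assoc, Equiv.swap_mul_self, mul_one] at h
  rw [abs_le]
  constructor <;> linarith [hle σ]

/-- The covariance of `φ(σ)` with its exponential weight is bounded by the weighted mean
of `φ(σ)` itself. -/
lemma abs_sum_centered_mul_exp_le (hn : 1 ≤ n) {φ : MvPolynomial (Fin n × Fin n) ℝ}
    (hpos : ∀ m, 0 ≤ φ.coeff m) {d : ℕ} (hd : 1 ≤ d) (hdeg : φ.totalDegree ≤ d) {c θ : ℝ}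
    (hc : 0 ≤ c) (hgrad : ∀ σ, ∀ q : Fin n × Fin n, |permEval n (pderiv q φ) σ| ≤ c)
    (hθ : 6 * d * c * |θ| ≤ 1) :
    |∑ σ, (permEval n φ σ - permExp n φ) * Real.exp (θ * permEval n φ σ)| ≤
      6 * d * c * |θ| * ∑ σ, permEval n φ σ * Real.exp (θ * permEval n φ σ) := by
  have hinc := abs_permEval_sub_mul_swap_le hpos hgrad
  have hcov := abs_covariance_le_of_increments_le (permEval n φ)
    (fun σ => Real.exp (θ * permEval n φ σ)) (2 * c) hinc
  have hd' : (1 : ℝ) ≤ d := by exact_mod_cast hd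
  have hsmall : |θ| * (2 * c) ≤ 1 / 3 := by
    have : 0 ≤ |θ| * c := by positivity
    nlinarith
  have hsum := sum_abs_exp_increments_le hpos hdeg hinc hsmall
  have hn' : (0 : ℝ) < n := by exact_mod_cast hn
  set N : ℝ := (Fintype.card (Equiv.Perm (Fin n)) : ℝ) with hN
  have hN0 : 0 < N := by rw [hN]; exact_mod_cast Fintype.card_pos
  have e : N * ∑ σ, permEval n φ σ * Real.exp (θ * permEval n φ σ) -
      (∑ σ, permEval n φ σ) * ∑ σ, Real.exp (θ * permEval n φ σ) =
      N * ∑ σ, (permEval n φ σ - permExp n φ) * Real.exp (θ * permEval n φ σ) := by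
    simp only [sub_mul, Finset.sum_sub_distrib, ← Finset.mul_sum]
    rw [permExp, ← hN]
    generalize ∑ σ, permEval n φ σ * Real.exp (θ * permEval n φ σ) = A
    generalize ∑ σ, Real.exp (θ * permEval n φ σ) = B
    field_simp
  rw [e, abs_mul, abs_of_pos hN0, Fintype.card_fin] at hcov
  refine (le_of_mul_le_mul_left hcov hN0).trans ?_
  refine (mul_le_mul_of_nonneg_left hsum (by positivity)).trans (le_of_eq ?_)
  generalize ∑ σ, permEval n φ σ * Real.exp (θ * permEval n φ σ) = A
  field_simp

lemma hasDerivAt_logMgf (φ : MvPolynomial (Fin n × Fin n) ℝ) (θ : ℝ) :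
    HasDerivAt (logMgf n φ)
      ((∑ σ, (permEval n φ σ - permExp n φ) * Real.exp (θ * permEval n φ σ)) /
        ∑ σ, Real.exp (θ * permEval n φ σ)) θ := by
  set N : ℝ := (Fintype.card (Equiv.Perm (Fin n)) : ℝ) with hN
  have hN0 : 0 < N := by rw [hN]; exact_mod_cast Fintype.card_pos
  set f := permEval n φ
  set μ := permExp n φ
  have h1 : HasDerivAt (fun t => (∑ σ, Real.exp (t * (f σ - μ))) / N)
      ((∑ σ, Real.exp (θ * (f σ - μ)) * (f σ - μ)) / N) θ := by
    refine HasDerivAt.div_const ?_ _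
    refine HasDerivAt.fun_sum fun σ _ => ?_
    exact (hasDerivAt_mul_const (f σ - μ)).exp
  have hS : 0 < ∑ σ, Real.exp (θ * (f σ - μ)) :=
    Finset.sum_pos (fun _ _ => Real.exp_pos _) Finset.univ_nonempty
  have h2 := h1.log (div_pos hS hN0).ne'
  have e : ∀ σ, Real.exp (θ * (f σ - μ)) = Real.exp (-(θ * μ)) * Real.exp (θ * f σ) := fun σ => by
    rw [← Real.exp_add]; ring_nf
  have hS' : 0 < ∑ σ, Real.exp (θ * f σ) :=
    Finset.sum_pos (fun _ _ => Real.exp_pos _) Finset.univ_nonempty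
  refine h2.congr_deriv ?_
  simp only [e, mul_assoc, ← Finset.mul_sum]
  rw [div_div_div_cancel_right₀ hN0.ne', mul_div_mul_left _ _ (Real.exp_pos _).ne']
  simp only [mul_comm]

lemma logMgf_zero (φ : MvPolynomial (Fin n × Fin n) ℝ) : logMgf n φ 0 = 0 := by
  simp [logMgf]

lemma abs_deriv_logMgf_le (hn : 1 ≤ n) {φ : MvPolynomial (Fin n × Fin n) ℝ}
    (hpos : ∀ m, 0 ≤ φ.coeff m) {d : ℕ} (hd : 1 ≤ d) (hdeg : φ.totalDegree ≤ d) {c θ : ℝ}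
    (hc : 0 ≤ c) (hgrad : ∀ σ, ∀ q : Fin n × Fin n, |permEval n (pderiv q φ) σ| ≤ c)
    (hθ : 6 * d * c * |θ| ≤ 1) :
    |deriv (logMgf n φ) θ| ≤ 6 * d * c * |θ| * (deriv (logMgf n φ) θ + permExp n φ) := by
  have hS' : 0 < ∑ σ, Real.exp (θ * permEval n φ σ) :=
    Finset.sum_pos (fun _ _ => Real.exp_pos _) Finset.univ_nonempty
  have h := abs_sum_centered_mul_exp_le hn hpos hd hdeg hc hgrad hθ
  rw [(hasDerivAt_logMgf φ θ).deriv, abs_div, abs_of_pos hS', div_le_iff₀ hS']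
  refine h.trans (le_of_eq ?_)
  simp only [sub_mul, Finset.sum_sub_distrib, ← Finset.mul_sum]
  generalize ∑ σ, permEval n φ σ * Real.exp (θ * permEval n φ σ) = A
  generalize ∑ σ, Real.exp (θ * permEval n φ σ) = B at hS'
  field_simp
  ring

end MomentGeneratingFunction

lemma permExp_nonneg {n : ℕ} {φ : MvPolynomial (Fin n × Fin n) ℝ} (hpos : ∀ m, 0 ≤ φ.coeff m) :
    0 ≤ permExp n φ :=
  div_nonneg (Finset.sum_nonneg fun σ _ => permEval_nonneg hpos σ) (Nat.cast_nonneg _)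

lemma le_betaConst {n d : ℕ} (hn : 1 ≤ n) {CD CD' : ℝ} (hCD' : 0 ≤ CD') :
    6 * d * CD' ≤ betaConst n d CD CD' := by
  have hn' : (0 : ℝ) < n := by exact_mod_cast hn
  have hx : 0 < 2 / (n : ℝ) := by positivity
  rw [betaConst, neg_div]
  generalize 2 / (n : ℝ) = x at hx
  have h1 : Real.exp (-x) < 1 := Real.exp_zero ▸ Real.exp_lt_exp.2 (by linarith)
  have h2 : 1 - x ≤ Real.exp (-x) := Real.one_sub_le_exp_neg x
  have h3 : 1 ≤ x * (2 - Real.exp (-x)) / (1 - Real.exp (-x)) := by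
    rw [le_div_iff₀ (by linarith)]
    nlinarith
  refine le_mul_of_one_le_right (by positivity) ?_
  linarith [le_max_left 0 (Real.log (4 * CD * n / CD'))]

/-- Lemma 9.2: bound on the moment generating function of a low-degree function on
the symmetric group. -/
theorem mgf_bound_low_degree (n d : ℕ) (hn : 1 ≤ n) (hd1 : 1 ≤ d) (hdn : d ≤ n)
    (φ : MvPolynomial (Fin n × Fin n) ℝ)
    (hml : IsMultilinear n φ) (hdeg : φ.totalDegree ≤ d)
    (hpos : ∀ m, 0 ≤ φ.coeff m)
    (CD CD' CU : ℝ) (hCD : 0 ≤ CD) (hCD' : 0 ≤ CD') (hCU : 0 ≤ CU)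
    (hD : ∀ k ≤ d, ∀ σ, |permEval n ((Dop n)^[k] φ) σ| ≤ CD)
    (hDgrad : ∀ k ≤ d, ∀ σ, ∀ q : Fin n × Fin n,
      |permEval n (pderiv q ((Dop n)^[k] φ)) σ| ≤ CD')
    (hDU : ∀ k ≤ d, ∀ σ, |permEval n ((Dop n)^[k] (Uop n φ)) σ| ≤ CU) :
    (∀ θ : ℝ, 0 ≤ θ → θ < 1 / betaConst n d CD CD' →
      logMgf n φ θ ≤
        gammaConst n d CD CD' CU (permExp n φ) * θ ^ 2 /
          (2 * (1 - betaConst n d CD CD' * θ))) ∧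
    (∀ θ : ℝ, -(1 / betaConst n d CD CD') < θ → θ ≤ 0 →
      logMgf n φ θ ≤ gammaConst n d CD CD' CU (permExp n φ) * θ ^ 2 / 2) := by
  have hgrad : ∀ σ, ∀ q : Fin n × Fin n, |permEval n (pderiv q φ) σ| ≤ CD' := by
    simpa using hDgrad 0 (Nat.zero_le d)
  have hβ : 6 * d * CD' ≤ betaConst n d CD CD' := le_betaConst hn hCD'
  have hμ : 0 ≤ permExp n φ := permExp_nonneg hpos
  have hγ : betaConst n d CD CD' * permExp n φ ≤ gammaConst n d CD CD' CU (permExp n φ) := by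
    have hβ0 : 0 ≤ betaConst n d CD CD' := le_trans (by positivity) hβ
    have := mul_nonneg hβ0 hμ
    have := mul_nonneg hβ0 hCU
    rw [gammaConst]
    linarith
  set β := betaConst n d CD CD'
  set μ := permExp n φ
  set γ := gammaConst n d CD CD' CU μ
  have hβ0 : 0 ≤ β := le_trans (by positivity) hβ
  have hγ0 : 0 ≤ γ := (mul_nonneg hβ0 hμ).trans hγ
  have hdiff : Differentiable ℝ (logMgf n φ) := fun t => (hasDerivAt_logMgf φ t).differentiableAt
  have hquad : ∀ r t : ℝ, HasDerivAt (fun s => r * s ^ 2 / 2) (r * t) t := fun r t => by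
    have := ((hasDerivAt_pow 2 t).const_mul r).div_const 2
    refine this.congr_deriv ?_
    norm_num
    ring
  have hderiv : ∀ r t : ℝ, deriv (fun s => r * s ^ 2 / 2 - logMgf n φ s) t =
      r * t - deriv (logMgf n φ) t := fun r t =>
    ((hquad r t).sub (hdiff t).hasDerivAt).deriv
  have hcont : ∀ r : ℝ, Differentiable ℝ (fun s => r * s ^ 2 / 2 - logMgf n φ s) := fun r t =>
    ((hquad r t).sub (hdiff t).hasDerivAt).differentiableAt
  have hbound : ∀ t : ℝ, β * |t| ≤ 1 → |deriv (logMgf n φ) t| ≤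
      6 * d * CD' * |t| * (deriv (logMgf n φ) t + μ) := fun t ht =>
    abs_deriv_logMgf_le hn hpos hd1 hdeg hCD' hgrad
      ((mul_le_mul_of_nonneg_right hβ (abs_nonneg t)).trans ht)
  constructor
  · intro θ h0 hθ
    have hβpos : 0 < β := by
      rcases hβ0.eq_or_lt with h | h
      · rw [← h, div_zero] at hθ; linarith
      · exact h
    have hβθ : β * θ < 1 := by rwa [lt_div_iff₀' hβpos] at hθ
    have hmono : MonotoneOn (fun s => γ / (1 - β * θ) * s ^ 2 / 2 - logMgf n φ s)
        (Set.Icc 0 θ) := by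
      refine monotoneOn_of_deriv_nonneg (convex_Icc 0 θ) (hcont _).continuous.continuousOn
        (hcont _).differentiableOn fun t ht => ?_
      rw [interior_Icc] at ht
      obtain ⟨ht0, htθ⟩ := ht
      rw [hderiv, sub_nonneg, div_mul_eq_mul_div, le_div_iff₀ (by linarith)]
      have hβt : β * t ≤ β * θ := mul_le_mul_of_nonneg_left htθ.le hβ0
      have hb := hbound t (by rw [abs_of_pos ht0]; linarith)
      rw [abs_of_pos ht0] at hb
      generalize deriv (logMgf n φ) t = D at hb
      rcases le_or_gt D 0 with hD0 | hD0
      · exact (mul_nonpos_of_nonpos_of_nonneg hD0 (by linarith)).trans (mul_nonneg hγ0 ht0.le)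
      · rw [abs_of_pos hD0] at hb
        have h1 : 6 * d * CD' * t * (D + μ) ≤ β * t * (D + μ) :=
          mul_le_mul_of_nonneg_right (mul_le_mul_of_nonneg_right hβ ht0.le) (by linarith)
        have h2 := mul_le_mul_of_nonneg_right hγ ht0.le
        have h3 := mul_le_mul_of_nonneg_left hβt hD0.le
        linarith
    have := hmono (Set.left_mem_Icc.2 h0) (Set.right_mem_Icc.2 h0) h0
    simp only [logMgf_zero] at this
    have e : γ * θ ^ 2 / (2 * (1 - β * θ)) = γ / (1 - β * θ) * θ ^ 2 / 2 := by
      have : 1 - β * θ ≠ 0 := by linarith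
      field_simp
    rw [e]
    linarith
  · intro θ hθ h0
    have hβpos : 0 < β := by
      rcases hβ0.eq_or_lt with h | h
      · rw [← h, div_zero] at hθ; linarith
      · exact h
    have hβθ : β * (-θ) < 1 := by
      have : -θ < 1 / β := by linarith
      rwa [lt_div_iff₀' hβpos] at this
    have hmono : AntitoneOn (fun s => γ * s ^ 2 / 2 - logMgf n φ s) (Set.Icc θ 0) := by
      refine antitoneOn_of_deriv_nonpos (convex_Icc θ 0) (hcont _).continuous.continuousOn
        (hcont _).differentiableOn fun t ht => ?_
      rw [interior_Icc] at ht
      obtain ⟨htθ, ht0⟩ := ht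
      rw [hderiv, sub_nonpos]
      have hβt : β * (-t) ≤ β * (-θ) := mul_le_mul_of_nonneg_left (by linarith) hβ0
      have hb := hbound t (by rw [abs_of_neg ht0]; linarith)
      rw [abs_of_neg ht0] at hb
      generalize deriv (logMgf n φ) t = D at hb
      have hnt : 0 ≤ -t := by linarith
      have h2 := mul_le_mul_of_nonneg_right hγ hnt
      rcases le_or_gt 0 D with hD0 | hD0
      · exact (mul_nonpos_of_nonneg_of_nonpos hγ0 ht0.le).trans hD0
      · rw [abs_of_neg hD0] at hb
        have h1 : 6 * d * CD' * -t * (D + μ) ≤ 6 * d * CD' * -t * μ :=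
          mul_le_mul_of_nonneg_left (by linarith) (by positivity)
        have h3 : 6 * d * CD' * -t * μ ≤ β * -t * μ :=
          mul_le_mul_of_nonneg_right (mul_le_mul_of_nonneg_right hβ hnt) hμ
        linarith
    have := hmono (Set.left_mem_Icc.2 h0) (Set.right_mem_Icc.2 h0) h0
    simp only [logMgf_zero] at this
    linarith
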